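/- Let A, A⁽¹⁾ : ℝ × ℝ → ℂ be smooth functions of (x̄, t̄), let r : ℝ → (0, ∞) be continuously differentiable, and let μ̄ : ℝ → ℝ. Define ψ⁰(x, x̄, t̄) = A(x̄, t̄)e^{ix} + Ā(x̄, t̄)e^{−ix}, ψ¹(x, x̄, t̄) = A⁽¹⁾(x̄, t̄)e^{ix} + conj., ρ(t̄) = r'(t̄)/r(t̄), and B²(x, x̄, t̄) = −(∂_{t̄}ψ⁰ + ρ(t̄)ψ⁰) − 4 ∂_{x̄}∂_x(1 + ∂_x²)ψ¹ − 2 ∂_{x̄}²(1 + 3∂_x²)ψ⁰ + μ̄(t̄)ψ⁰ − (ψ⁰)³. Then ∫₀^{2π} B²(x, x̄, t̄) e^{−ix} dx = 0 for all (x̄, t̄) ∈ ℝ² if and only if A satisfies the real Ginzburg–Landau equation ∂_{t̄}A = 4∂_{x̄}²A + (μ̄(t̄) − ρ(t̄))A − 3A|A|² on ℝ². -/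

import Mathlib

/-- Partial derivative `∂_x` of a function of `(x, x̄, t̄)`. -/
noncomputable def pX (F : ℝ → ℝ → ℝ → ℂ) : ℝ → ℝ → ℝ → ℂ :=
  fun x y t => deriv (fun s => F s y t) x

/-- Partial derivative `∂_{x̄}` of a function of `(x, x̄, t̄)`. -/
noncomputable def pXbar (F : ℝ → ℝ → ℝ → ℂ) : ℝ → ℝ → ℝ → ℂ :=
  fun x y t => deriv (fun s => F x s t) y

/-- Partial derivative `∂_{t̄}` of a function of `(x, x̄, t̄)`. -/
noncomputable def pTbar (F : ℝ → ℝ → ℝ → ℂ) : ℝ → ℝ → ℝ → ℂ :=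
  fun x y t => deriv (fun s => F x y s) t

/-- Partial derivative `∂_{x̄}` of a function of `(x̄, t̄)`. -/
noncomputable def qXbar (G : ℝ → ℝ → ℂ) : ℝ → ℝ → ℂ :=
  fun y t => deriv (fun s => G s t) y

/-- Partial derivative `∂_{t̄}` of a function of `(x̄, t̄)`. -/
noncomputable def qTbar (G : ℝ → ℝ → ℂ) : ℝ → ℝ → ℂ :=
  fun y t => deriv (fun s => G y s) t

/-- `ψ(x, x̄, t̄) = A(x̄, t̄)e^{ix} + Ā(x̄, t̄)e^{-ix}`. -/
noncomputable def shMode (A : ℝ → ℝ → ℂ) : ℝ → ℝ → ℝ → ℂ :=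
  fun x y t => A y t * Complex.exp (Complex.I * x)
    + (starRingEnd ℂ) (A y t) * Complex.exp (-(Complex.I * x))

/-- `ρ(t̄) = r'(t̄)/r(t̄)`. -/
noncomputable def rhoOf (r : ℝ → ℝ) : ℝ → ℝ := fun t => deriv r t / r t

/-- The order-`r²` right-hand side
`B² = -(∂_{t̄}ψ⁰ + ρψ⁰) - 4∂_{x̄}∂_x(1 + ∂_x²)ψ¹ - 2∂_{x̄}²(1 + 3∂_x²)ψ⁰ + μ̄ψ⁰ - (ψ⁰)³`
of the multiple-scales expansion for the blown-up Swift–Hohenberg equation. -/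
noncomputable def B2SH (A A1 : ℝ → ℝ → ℂ) (r μ : ℝ → ℝ) : ℝ → ℝ → ℝ → ℂ :=
  fun x y t =>
    -(pTbar (shMode A) x y t + (rhoOf r t : ℂ) * shMode A x y t)
      - 4 * pXbar (pX (shMode A1 + pX (pX (shMode A1)))) x y t
      - 2 * pXbar (pXbar (shMode A + (3 : ℂ) • pX (pX (shMode A)))) x y t
      + (μ t : ℂ) * shMode A x y t - (shMode A x y t) ^ 3

theorem pX_pX_shMode (A : ℝ → ℝ → ℂ) : pX (pX (shMode A)) = -shMode A := by
  have hexp (c : ℂ) (x : ℝ) :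
      HasDerivAt (fun s : ℝ => Complex.exp (c * s)) (Complex.exp (c * x) * c) x := by
    simpa using ((Complex.ofRealCLM.hasDerivAt (x := x)).const_mul c).cexp
  have hlin (a b : ℂ) (x : ℝ) :
      HasDerivAt (fun s : ℝ => a * Complex.exp (Complex.I * s) + b * Complex.exp (-(Complex.I * s)))
        (a * Complex.I * Complex.exp (Complex.I * x)
          + -(b * Complex.I) * Complex.exp (-(Complex.I * x))) x := by
    have h := ((hexp Complex.I x).const_mul a).add ((hexp (-Complex.I) x).const_mul b)
    simp only [neg_mul] at h
    exact h.congr_deriv (by ring)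
  have hfirst : pX (shMode A) = fun (x y t : ℝ) =>
      A y t * Complex.I * Complex.exp (Complex.I * x)
        + -((starRingEnd ℂ) (A y t) * Complex.I) * Complex.exp (-(Complex.I * x)) := by
    funext x y t
    exact (hlin _ _ x).deriv
  rw [hfirst]
  funext x y t
  refine (hlin _ _ x).deriv.trans ?_
  simp only [shMode, Pi.neg_apply]
  linear_combination (A y t * Complex.exp (Complex.I * x)
    + (starRingEnd ℂ) (A y t) * Complex.exp (-(Complex.I * x))) * Complex.I_mul_I

theorem hasDerivAt_mode {a : ℝ → ℂ} {a' : ℂ} {s : ℝ} (h : HasDerivAt a a' s) (z w : ℂ) :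
    HasDerivAt (fun s => a s * z + (starRingEnd ℂ) (a s) * w)
      (a' * z + (starRingEnd ℂ) a' * w) s :=
  (h.mul_const z).add (h.star.mul_const w)

theorem pXbar_shMode {A : ℝ → ℝ → ℂ} (hA : ∀ t, Differentiable ℝ fun s => A s t) :
    pXbar (shMode A) = shMode (qXbar A) := by
  funext x y t
  exact (hasDerivAt_mode (hA t y).hasDerivAt _ _).deriv

theorem pTbar_shMode {A : ℝ → ℝ → ℂ} (hA : ∀ y, Differentiable ℝ (A y)) :
    pTbar (shMode A) = shMode (qTbar A) := by
  funext x y t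
  exact (hasDerivAt_mode (hA y t).hasDerivAt _ _).deriv

theorem pXbar_const_smul (c : ℂ) (F : ℝ → ℝ → ℝ → ℂ) : pXbar (c • F) = c • pXbar F := by
  funext x y t
  exact deriv_const_smul_field c _

theorem integral_cexp_int_mul_I {n : ℤ} (hn : n ≠ 0) :
    ∫ x in (0 : ℝ)..(2 * Real.pi), Complex.exp (n * Complex.I * x) = 0 := by
  have hc : (n : ℂ) * Complex.I ≠ 0 := mul_ne_zero (Int.cast_ne_zero.mpr hn) Complex.I_ne_zero
  have hper : Complex.exp (n * Complex.I * ((2 * Real.pi : ℝ) : ℂ)) = 1 :=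
    Complex.exp_eq_one_iff.mpr ⟨n, by push_cast; ring⟩
  rw [integral_exp_mul_complex hc, hper]
  simp

theorem integral_mode_sub_cube_mul_cexp (a b c d : ℂ) :
    ∫ x in (0 : ℝ)..(2 * Real.pi),
      ((c * Complex.exp (Complex.I * x) + d * Complex.exp (-(Complex.I * x)))
        - (a * Complex.exp (Complex.I * x) + b * Complex.exp (-(Complex.I * x))) ^ 3)
        * Complex.exp (-(Complex.I * x)) = 2 * Real.pi * (c - 3 * a ^ 2 * b) := by
  have hexpand (x : ℝ) :
      ((c * Complex.exp (Complex.I * x) + d * Complex.exp (-(Complex.I * x)))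
        - (a * Complex.exp (Complex.I * x) + b * Complex.exp (-(Complex.I * x))) ^ 3)
        * Complex.exp (-(Complex.I * x))
      = (c - 3 * a ^ 2 * b) + (d - 3 * a * b ^ 2) * Complex.exp ((-2 : ℤ) * Complex.I * x)
        + -a ^ 3 * Complex.exp ((2 : ℤ) * Complex.I * x)
        + -b ^ 3 * Complex.exp ((-4 : ℤ) * Complex.I * x) := by
    have h2 : Complex.exp ((2 : ℤ) * Complex.I * x) = Complex.exp (Complex.I * x) ^ 2 := by
      rw [← Complex.exp_nat_mul]; push_cast; ring_nf
    have h2' : Complex.exp ((-2 : ℤ) * Complex.I * x) = Complex.exp (-(Complex.I * x)) ^ 2 := by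
      rw [← Complex.exp_nat_mul]; push_cast; ring_nf
    have h4 : Complex.exp ((-4 : ℤ) * Complex.I * x) = Complex.exp (-(Complex.I * x)) ^ 4 := by
      rw [← Complex.exp_nat_mul]; push_cast; ring_nf
    have hinv : Complex.exp (Complex.I * x) * Complex.exp (-(Complex.I * x)) = 1 := by
      rw [← Complex.exp_add]; simp
    rw [h2, h2', h4]
    generalize Complex.exp (Complex.I * x) = e at hinv ⊢
    generalize Complex.exp (-(Complex.I * x)) = f at hinv ⊢
    linear_combination (c - a ^ 3 * e ^ 2 - 3 * a ^ 2 * b * (e * f + 1)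
      - 3 * a * b ^ 2 * f ^ 2) * hinv
  have hint (k : ℂ) (n : ℤ) : IntervalIntegrable
      (fun x : ℝ => k * Complex.exp (n * Complex.I * x)) MeasureTheory.volume 0 (2 * Real.pi) :=
    (by fun_prop : Continuous fun x : ℝ => k * Complex.exp (n * Complex.I * x)).intervalIntegrable
      _ _
  have hconst : IntervalIntegrable (fun _ : ℝ => c - 3 * a ^ 2 * b) MeasureTheory.volume 0
      (2 * Real.pi) := intervalIntegrable_const
  simp_rw [hexpand]
  rw [intervalIntegral.integral_add ((hconst.add (hint _ _)).add (hint _ _)) (hint _ _),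
    intervalIntegral.integral_add (hconst.add (hint _ _)) (hint _ _),
    intervalIntegral.integral_add hconst (hint _ _)]
  simp only [intervalIntegral.integral_const_mul, intervalIntegral.integral_const]
  rw [integral_cexp_int_mul_I (by norm_num), integral_cexp_int_mul_I (by norm_num),
    integral_cexp_int_mul_I (by norm_num)]
  simp [Complex.real_smul]

theorem B2SH_eq {A : ℝ → ℝ → ℂ} (A1 : ℝ → ℝ → ℂ) (r μ : ℝ → ℝ)
    (hy : ∀ t, Differentiable ℝ fun s => A s t)
    (hyy : ∀ t, Differentiable ℝ fun s => qXbar A s t)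
    (ht : ∀ y, Differentiable ℝ (A y)) (x y t : ℝ) :
    B2SH A A1 r μ x y t =
      shMode (fun y t => -qTbar A y t + 4 * qXbar (qXbar A) y t
        + ((μ t - rhoOf r t : ℝ) : ℂ) * A y t) x y t - shMode A x y t ^ 3 := by
  have hzero : pXbar (pX (0 : ℝ → ℝ → ℝ → ℂ)) x y t = 0 := by simp [pX, pXbar]
  have hsmul : shMode A + (3 : ℂ) • -shMode A = (-2 : ℂ) • shMode A := by module
  simp only [B2SH, pX_pX_shMode, add_neg_cancel, hzero, hsmul, pXbar_const_smul,
    pXbar_shMode hy, pXbar_shMode hyy, pTbar_shMode ht]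
  simp only [shMode, Pi.smul_apply, smul_eq_mul, map_add, map_neg, map_mul, Complex.conj_ofReal,
    map_ofNat]
  push_cast
  ring

/-- Fredholm solvability condition at order `r²` for the blown-up dynamic
Swift–Hohenberg equation: `∫₀^{2π} B² e^{-ix} dx = 0` for all `(x̄, t̄)` iff `A`
satisfies the real Ginzburg–Landau modulation equation
`∂_{t̄}A = 4∂_{x̄}²A + (μ̄(t̄) - ρ(t̄))A - 3A|A|²`. -/
theorem swift_hohenberg_solvability (A A1 : ℝ → ℝ → ℂ)
    (hA : ContDiff ℝ (⊤ : ℕ∞) (fun p : ℝ × ℝ => A p.1 p.2))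
    (hA1 : ContDiff ℝ (⊤ : ℕ∞) (fun p : ℝ × ℝ => A1 p.1 p.2))
    (r : ℝ → ℝ) (hr : ∀ t, 0 < r t) (hr1 : ContDiff ℝ 1 r) (μ : ℝ → ℝ) :
    (∀ y t : ℝ,
        ∫ x in (0 : ℝ)..(2 * Real.pi),
          B2SH A A1 r μ x y t * Complex.exp (-(Complex.I * x)) = 0) ↔
    (∀ y t : ℝ,
        qTbar A y t = 4 * qXbar (qXbar A) y t
          + ((μ t - rhoOf r t : ℝ) : ℂ) * A y t
          - 3 * A y t * (‖A y t‖ : ℂ) ^ 2) := by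
  have hslice (t : ℝ) : ContDiff ℝ (⊤ : ℕ∞) fun s => A s t :=
    hA.comp (contDiff_id.prodMk contDiff_const)
  have hy (t : ℝ) : Differentiable ℝ fun s => A s t := (hslice t).differentiable (by simp)
  have hyy (t : ℝ) : Differentiable ℝ fun s => qXbar A s t :=
    (contDiff_infty_iff_deriv.mp (hslice t)).2.differentiable (by simp)
  have ht (y : ℝ) : Differentiable ℝ (A y) :=
    (hA.comp (contDiff_const.prodMk contDiff_id)).differentiable (by simp)
  refine forall₂_congr fun y t => ?_
  simp_rw [B2SH_eq A1 r μ hy hyy ht, shMode]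
  rw [integral_mode_sub_cube_mul_cexp]
  have hpi : (2 * Real.pi : ℂ) ≠ 0 := by exact_mod_cast Real.two_pi_pos.ne'
  have hnorm : A y t * (starRingEnd ℂ) (A y t) = (‖A y t‖ : ℂ) ^ 2 := Complex.mul_conj' _
  rw [mul_eq_zero, or_iff_right hpi]
  constructor <;> intro h <;> linear_combination -h - 3 * A y t * hnorm
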